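/- Let Γ ⊂ ℝⁿ be a proper closed convex cone and A ⊂ ℝⁿ a nonempty bounded set. Define the Γ-hull Â_Γ = {x ∈ ℝⁿ : ⟨x,ξ⟩ ≤ φ_A(ξ) for all ξ ∈ Γ}, where φ_A(ξ) = sup_{a∈A} ⟨a,ξ⟩, and the dual cone Γ° = {x ∈ ℝⁿ : ⟨x,ξ⟩ ≥ 0 for all ξ ∈ Γ}. Then Â_Γ = ch(A) − Γ°, where ch(A) is the closed convex hull of A and the difference is the Minkowski difference {a − t : a ∈ ch(A), t ∈ Γ°}. -/

import Mathlib

open scoped BigOperators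

noncomputable section

/-- The Euclidean dot product on Fin n → ℝ. -/
def dotp {n : ℕ} (x y : Fin n → ℝ) : ℝ := ∑ i, x i * y i

/-- The supporting function of a set A. -/
def suppFn {n : ℕ} (A : Set (Fin n → ℝ)) (ξ : Fin n → ℝ) : ℝ :=
  sSup ((fun a => dotp a ξ) '' A)

theorem dotp_zero_left {n : ℕ} (x : Fin n → ℝ) : dotp 0 x = 0 :=
  zero_dotProduct x

theorem dotp_comm {n : ℕ} (x y : Fin n → ℝ) : dotp x y = dotp y x :=
  dotProduct_comm x y

theorem dotp_add_left {n : ℕ} (x y z : Fin n → ℝ) : dotp (x + y) z = dotp x z + dotp y z :=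
  add_dotProduct x y z

theorem dotp_sub_left {n : ℕ} (x y z : Fin n → ℝ) : dotp (x - y) z = dotp x z - dotp y z :=
  sub_dotProduct x y z

theorem dotp_smul_left {n : ℕ} (c : ℝ) (x y : Fin n → ℝ) : dotp (c • x) y = c * dotp x y :=
  smul_dotProduct c x y

theorem isLinearMap_dotp_left {n : ℕ} (ξ : Fin n → ℝ) : IsLinearMap ℝ fun x => dotp x ξ :=
  ⟨fun x y => dotp_add_left x y ξ, fun c x => dotp_smul_left c x ξ⟩

theorem continuous_dotp_left {n : ℕ} (ξ : Fin n → ℝ) : Continuous fun x => dotp x ξ := by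
  unfold dotp
  fun_prop

/-- Every continuous linear functional on `Fin n → ℝ` is the dot product with some vector. -/
theorem exists_eq_dotp {n : ℕ} (f : StrongDual ℝ (Fin n → ℝ)) :
    ∃ ξ : Fin n → ℝ, ∀ x, f x = dotp x ξ :=
  ⟨fun i => f fun j => if i = j then 1 else 0, fun x => f.toLinearMap.pi_apply_eq_sum_univ x⟩

theorem bddAbove_dotp_image {n : ℕ} {A : Set (Fin n → ℝ)} (hA : Bornology.IsBounded A)
    (ξ : Fin n → ℝ) : BddAbove ((fun a => dotp a ξ) '' A) :=
  (hA.isCompact_closure.bddAbove_image (continuous_dotp_left ξ).continuousOn).mono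
    (Set.image_mono subset_closure)

theorem dotp_le_suppFn_of_mem_closure_convexHull {n : ℕ} {A : Set (Fin n → ℝ)}
    (hA : Bornology.IsBounded A) {a : Fin n → ℝ} (ha : a ∈ closure (convexHull ℝ A))
    (ξ : Fin n → ℝ) : dotp a ξ ≤ suppFn A ξ := by
  refine closure_minimal (t := {y | dotp y ξ ≤ suppFn A ξ}) (convexHull_min ?_ ?_) ?_ ha
  · exact fun y hy => le_csSup (bddAbove_dotp_image hA ξ) ⟨y, hy, rfl⟩
  · exact convex_halfSpace_le (isLinearMap_dotp_left ξ) _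
  · exact isClosed_le (continuous_dotp_left ξ) continuous_const

/-- A linear functional bounded below on a cone is nonnegative on it. -/
theorem dotp_nonneg_of_forall_lt_smul {n : ℕ} {t ξ : Fin n → ℝ} {v : ℝ}
    (h : ∀ s : ℝ, 0 ≤ s → v < dotp (s • t) ξ) : 0 ≤ dotp t ξ := by
  by_contra! hneg
  have hv : v < 0 := by simpa [dotp_zero_left] using h 0 le_rfl
  have := h (v / dotp t ξ) (div_nonneg_of_nonpos hv.le hneg.le)
  rw [dotp_smul_left, div_mul_cancel₀ _ hneg.ne] at this
  exact this.false

/-- The bipolar theorem: a closed convex cone contains every vector that is nonnegative on its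
dual cone. -/
theorem mem_of_forall_dual_nonneg {n : ℕ} {Γ : Set (Fin n → ℝ)} (hne : Γ.Nonempty)
    (hcl : IsClosed Γ) (hconv : Convex ℝ Γ) (hcone : ∀ t : ℝ, 0 ≤ t → ∀ x ∈ Γ, t • x ∈ Γ)
    {ξ : Fin n → ℝ} (h : ∀ t : Fin n → ℝ, (∀ η ∈ Γ, 0 ≤ dotp t η) → 0 ≤ dotp t ξ) : ξ ∈ Γ := by
  by_contra hξ
  obtain ⟨g, v, hgξ, hgΓ⟩ := geometric_hahn_banach_point_closed hconv hcl hξ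
  obtain ⟨t, ht⟩ := exists_eq_dotp g
  simp only [ht] at hgξ hgΓ
  have hv : v < 0 := by
    obtain ⟨y, hy⟩ := hne
    simpa [dotp_zero_left] using hgΓ _ (hcone 0 le_rfl y hy)
  have hpos := h t fun η hη => by
    rw [dotp_comm]
    exact dotp_nonneg_of_forall_lt_smul fun s hs => hgΓ _ (hcone s hs η hη)
  rw [dotp_comm] at hpos
  linarith

theorem isClosed_dual {n : ℕ} (Γ : Set (Fin n → ℝ)) :
    IsClosed {t : Fin n → ℝ | ∀ ξ ∈ Γ, 0 ≤ dotp t ξ} := by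
  simp only [Set.ofPred_forall]
  exact isClosed_biInter fun ξ _ => isClosed_le continuous_const (continuous_dotp_left ξ)

theorem convex_dual {n : ℕ} (Γ : Set (Fin n → ℝ)) :
    Convex ℝ {t : Fin n → ℝ | ∀ ξ ∈ Γ, 0 ≤ dotp t ξ} := by
  simp only [Set.ofPred_forall]
  exact convex_iInter₂ fun ξ _ => convex_halfSpace_ge (isLinearMap_dotp_left ξ) 0

/-- For a proper closed convex cone Γ and a nonempty bounded set A,
    the Γ-hull Â_Γ = {x : ⟨x,ξ⟩ ≤ φ_A(ξ) ∀ξ ∈ Γ} equals ch(A) − Γ°,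
    where Γ° is the dual cone and ch(A) the closed convex hull. -/
theorem cone_hull_eq_chA_sub_dual (n : ℕ) (Γ : Set (Fin n → ℝ))
    (hΓne : Γ.Nonempty) (hΓcl : IsClosed Γ) (hΓconv : Convex ℝ Γ)
    (hΓcone : ∀ t : ℝ, 0 ≤ t → ∀ x ∈ Γ, t • x ∈ Γ)
    (hΓproper : Γ ∩ (-Γ) = {0})
    (A : Set (Fin n → ℝ)) (hAne : A.Nonempty) (hAb : Bornology.IsBounded A) :
    {x : Fin n → ℝ | ∀ ξ ∈ Γ, dotp x ξ ≤ suppFn A ξ} =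
      {x : Fin n → ℝ | ∃ a ∈ closure (convexHull ℝ A),
        ∃ t : Fin n → ℝ, (∀ ξ ∈ Γ, 0 ≤ dotp t ξ) ∧ x = a - t} := by
  ext x
  simp only [Set.mem_ofPred_eq]
  constructor
  · intro hx
    set K := closure (convexHull ℝ A)
    set D := {t : Fin n → ℝ | ∀ ξ ∈ Γ, 0 ≤ dotp t ξ}
    by_contra! hno
    have hdisj : Disjoint K ((fun t => x + t) '' D) := by
      rw [Set.disjoint_left]
      rintro _ ha ⟨t, ht, rfl⟩
      exact hno _ ha t ht (add_sub_cancel_right x t).symm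
    obtain ⟨f, u, v, hfK, huv, hfD⟩ := geometric_hahn_banach_compact_closed
      (convex_convexHull ℝ A).closure (isBounded_convexHull.2 hAb).isCompact_closure
      ((convex_dual Γ).translate x) ((Homeomorph.addLeft x).isClosedMap _ (isClosed_dual Γ)) hdisj
    obtain ⟨ξ, hξ⟩ := exists_eq_dotp f
    simp only [hξ] at hfK hfD
    have hshift : ∀ t ∈ D, v - dotp x ξ < dotp t ξ := fun t ht => by
      have := hfD _ ⟨t, ht, rfl⟩
      rw [dotp_add_left] at this
      linarith
    have hξΓ : ξ ∈ Γ := mem_of_forall_dual_nonneg hΓne hΓcl hΓconv hΓcone fun t ht =>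
      dotp_nonneg_of_forall_lt_smul fun s hs => hshift _ fun η hη => by
        rw [dotp_smul_left]
        exact mul_nonneg hs (ht η hη)
    have hsup : suppFn A ξ ≤ u := csSup_le (hAne.image _) <| by
      rintro _ ⟨a, ha, rfl⟩
      exact (hfK a (subset_closure (subset_convexHull ℝ A ha))).le
    have hvx := hshift 0 fun η _ => (dotp_zero_left η).ge
    rw [dotp_zero_left] at hvx
    linarith [hx ξ hξΓ]
  · rintro ⟨a, ha, t, ht, rfl⟩ ξ hξ
    rw [dotp_sub_left]
    linarith [dotp_le_suppFn_of_mem_closure_convexHull hAb ha ξ, ht ξ hξ]
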